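/- Let F₂ be the free group on generators a and b, let x₀ ∈ S¹, and let ρ, ρ' : F₂ → Homeo₊(S¹) be homomorphisms such that each of the two quintuples (x₀, ρ(ab⁻¹a⁻¹b)x₀, ρ(b)x₀, ρ(a⁻¹b)x₀, ρ(b⁻¹a⁻¹b)x₀) and (x₀, ρ'(ab⁻¹a⁻¹b)x₀, ρ'(b)x₀, ρ'(a⁻¹b)x₀, ρ'(b⁻¹a⁻¹b)x₀) consists of five pairwise distinct points in counterclockwise cyclic order (for a quintuple (p₁,p₂,p₃,p₄,p₅) this means ord(p₁,p₂,p₃) = ord(p₁,p₃,p₄) = ord(p₁,p₄,p₅) = 1). Then x₀ has trivial stabilizer under both ρ and ρ', and ord(ρ(g)x₀, ρ(h)x₀, ρ(k)x₀) = ord(ρ'(g)x₀, ρ'(h)x₀, ρ'(k)x₀) for all g, h, k ∈ F₂. -/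

import Mathlib

noncomputable section

open Classical in
/-- The circle `ℝ/ℤ`. -/
abbrev S1 : Type := AddCircle (1 : ℝ)

/-- The canonical representative of a point of the circle in `[0,1)`. -/
noncomputable def S1.rep (x : S1) : ℝ := (AddCircle.equivIco 1 0 x : ℝ)

open Classical in
/-- The orientation cocycle on the circle: `1` on positively oriented (counterclockwise)
triples of pairwise distinct points, `-1` on negatively oriented ones, `0` otherwise. -/
noncomputable def circOrd (x y z : S1) : ℤ :=
  if x = y ∨ y = z ∨ x = z then 0
  else if (S1.rep x < S1.rep y ∧ S1.rep y < S1.rep z) ∨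
      (S1.rep y < S1.rep z ∧ S1.rep z < S1.rep x) ∨
      (S1.rep z < S1.rep x ∧ S1.rep x < S1.rep y) then 1 else -1

/-- The group `Homeo₊(S¹)` of orientation preserving homeomorphisms of the circle, realized
as the subgroup of bijections of `S¹` which are homeomorphisms and preserve the orientation
cocycle. -/
noncomputable def HomeoPos : Subgroup (Equiv.Perm S1) where
  carrier := {f | Continuous f ∧ Continuous f.symm ∧
    ∀ x y z, circOrd (f x) (f y) (f z) = circOrd x y z}
  one_mem' := ⟨by simpa using continuous_id, (continuous_id : Continuous (id : S1 → S1)), by simp⟩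
  mul_mem' := by
    rintro a b ⟨ha1, ha2, ha3⟩ ⟨hb1, hb2, hb3⟩
    refine ⟨?_, ?_, ?_⟩
    · have : ⇑(a * b) = ⇑a ∘ ⇑b := by ext x; simp [Equiv.Perm.mul_apply]
      rw [this]; exact ha1.comp hb1
    · have : ⇑(a * b).symm = ⇑b.symm ∘ ⇑a.symm := by
        ext x; rfl
      rw [this]; exact hb2.comp ha2
    · intro x y z
      simp only [Equiv.Perm.mul_apply]
      rw [ha3, hb3]
  inv_mem' := by
    rintro a ⟨ha1, ha2, ha3⟩
    refine ⟨ha2, ha1, ?_⟩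
    intro x y z
    have := ha3 (a⁻¹ x) (a⁻¹ y) (a⁻¹ z)
    simpa using this.symm

/-- The action of an element of `Homeo₊(S¹)` on the circle. -/
def ap (h : ↥HomeoPos) (x : S1) : S1 := h.1 x

lemma ap_one (x : S1) : ap 1 x = x := rfl

lemma ap_mul (h₁ h₂ : ↥HomeoPos) (x : S1) : ap (h₁ * h₂) x = ap h₁ (ap h₂ x) := rfl

variable {G : Type*} [Group G]

/-- A (left-invariant) circular order on a group `G`: a function `G³ → {-1,0,1}` vanishing
exactly on degenerate triples, satisfying the cocycle identity, and left-invariant. -/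
def IsCircularOrder (c : G → G → G → ℤ) : Prop :=
  (∀ a b d, c a b d = 0 ↔ a = b ∨ b = d ∨ a = d) ∧
  (∀ a b d, c a b d = 1 ∨ c a b d = 0 ∨ c a b d = -1) ∧
  (∀ g₁ g₂ g₃ g₄, c g₂ g₃ g₄ - c g₁ g₃ g₄ + c g₁ g₂ g₄ - c g₁ g₂ g₃ = 0) ∧
  (∀ g u v w, c (g * u) (g * v) (g * w) = c u v w)

/-- `c` is an isolated point of the space `CO(G)` of circular orders on `G` (with the
topology induced from the product topology on `{-1,0,1}^{G³}`): some basic neighborhood,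
determined by agreement on a finite subset of `G`, contains only `c`. -/
def IsIsolatedCO (c : G → G → G → ℤ) : Prop :=
  ∃ S : Finset G, ∀ c' : G → G → G → ℤ, IsCircularOrder c' →
    (∀ u ∈ S, ∀ v ∈ S, ∀ w ∈ S, c' u v w = c u v w) → c' = c

/-- The basepoint `x₀` has trivial stabilizer under the action `ρ`. -/
def TrivialStabilizer (ρ : G →* ↥HomeoPos) (x₀ : S1) : Prop :=
  ∀ g : G, ap (ρ g) x₀ = x₀ → g = 1

/-- The circular order on `G` induced by the orbit of a point `x₀` with trivial stabilizer. -/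
def inducedCO (ρ : G →* ↥HomeoPos) (x₀ : S1) (g₁ g₂ g₃ : G) : ℤ :=
  circOrd (ap (ρ g₁) x₀) (ap (ρ g₂) x₀) (ap (ρ g₃) x₀)

/-- A continuous degree-one monotone map of the circle: a continuous surjection which
weakly preserves the orientation cocycle. -/
def DegOneMonotone (f : S1 → S1) : Prop :=
  Continuous f ∧ Function.Surjective f ∧
    ∀ x y z, f x ≠ f y → f y ≠ f z → f x ≠ f z → circOrd (f x) (f y) (f z) = circOrd x y z

/-- `ρ` is a dynamical realization of the circular order `c` with basepoint `x₀`. -/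
def IsDynamicalRealization (ρ : G →* ↥HomeoPos) (x₀ : S1) (c : G → G → G → ℤ) : Prop :=
  TrivialStabilizer ρ x₀ ∧
  (∀ g₁ g₂ g₃, inducedCO ρ x₀ g₁ g₂ g₃ = c g₁ g₂ g₃) ∧
  ∀ ρ' : G →* ↥HomeoPos, TrivialStabilizer ρ' x₀ →
    (∀ g₁ g₂ g₃, inducedCO ρ' x₀ g₁ g₂ g₃ = c g₁ g₂ g₃) →
    ∃ f : S1 → S1, DegOneMonotone f ∧ f x₀ = x₀ ∧
      ∀ g : G, (ap (ρ g)) ∘ f = f ∘ (ap (ρ' g))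

end

noncomputable section

/-- orientation cocycle of a linear order -/
def cyc3 {α : Type} [LinearOrder α] (x y z : α) : ℤ :=
  if x = y ∨ y = z ∨ x = z then 0
  else if (x < y ∧ y < z) ∨ (y < z ∧ z < x) ∨ (z < x ∧ x < y) then 1 else -1

lemma rep_inj {x y : S1} (h : S1.rep x = S1.rep y) : x = y := by
  unfold S1.rep at h
  exact (AddCircle.equivIco 1 0).injective (Subtype.ext h)

lemma rep_nonneg (x : S1) : 0 ≤ S1.rep x := (AddCircle.equivIco (1 : ℝ) 0 x).2.1

lemma rep_lt (x : S1) : S1.rep x < 1 := by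
  have := (AddCircle.equivIco (1 : ℝ) 0 x).2.2
  unfold S1.rep
  linarith

lemma circOrd_eq_cyc3 (x y z : S1) :
    circOrd x y z = cyc3 (S1.rep x) (S1.rep y) (S1.rep z) := by
  have e : ∀ u v : S1, u = v ↔ S1.rep u = S1.rep v :=
    fun u v => ⟨fun h => by rw [h], rep_inj⟩
  unfold circOrd cyc3
  simp only [e]

lemma cyc3_cut (c x y z : ℝ) (hx : 0 ≤ x ∧ x < 1) (hy : 0 ≤ y ∧ y < 1) (hz : 0 ≤ z ∧ z < 1) :
    cyc3 x y z = cyc3 (if x < c then x + 1 else x) (if y < c then y + 1 else y)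
      (if z < c then z + 1 else z) := by
  unfold cyc3
  grind

lemma exists_cut (x₀ : S1) : ∃ t : S1 → ℝ, Function.Injective t ∧ (∀ z, t x₀ ≤ t z) ∧
    ∀ x y z, circOrd x y z = cyc3 (t x) (t y) (t z) := by
  refine ⟨fun z => if S1.rep z < S1.rep x₀ then S1.rep z + 1 else S1.rep z, ?_, ?_, ?_⟩
  · intro x y h
    have h1 := rep_nonneg x
    have h2 := rep_nonneg y
    have h3 := rep_lt x
    have h4 := rep_lt y
    apply rep_inj
    dsimp only at h
    split_ifs at h <;> linarith
  · intro z
    have h1 := rep_nonneg z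
    have h4 := rep_lt x₀
    dsimp only
    split_ifs <;> linarith
  · intro x y z
    rw [circOrd_eq_cyc3]
    exact cyc3_cut _ _ _ _ ⟨rep_nonneg _, rep_lt _⟩ ⟨rep_nonneg _, rep_lt _⟩
      ⟨rep_nonneg _, rep_lt _⟩

lemma circOrd_ap (f : ↥HomeoPos) (x y z : S1) :
    circOrd (ap f x) (ap f y) (ap f z) = circOrd x y z := f.2.2.2 x y z

/-- slot of a letter -/
def letterIdx (s : Fin 2 × Bool) : ℕ :=
  if s.1 = 0 then (if s.2 then 1 else 3) else (if s.2 then 2 else 4)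

def wordIdx : List (Fin 2 × Bool) → ℕ
  | [] => 0
  | s :: _ => letterIdx s

def slot (u1 u2 u3 u4 v : ℝ) : ℕ :=
  if v < u1 then 0 else if v < u2 then 1 else if v < u3 then 2 else if v < u4 then 3 else 4

lemma cyc3_slot (u1 u2 u3 u4 x y z : ℝ) (h12 : u1 < u2) (h23 : u2 < u3) (h34 : u3 < u4)
    (hxy : slot u1 u2 u3 u4 x ≠ slot u1 u2 u3 u4 y)
    (hyz : slot u1 u2 u3 u4 y ≠ slot u1 u2 u3 u4 z)
    (hxz : slot u1 u2 u3 u4 x ≠ slot u1 u2 u3 u4 z) :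
    cyc3 x y z = cyc3 (slot u1 u2 u3 u4 x) (slot u1 u2 u3 u4 y) (slot u1 u2 u3 u4 z) := by
  have mono : ∀ v w, slot u1 u2 u3 u4 v < slot u1 u2 u3 u4 w → v < w := by
    intro v w h
    by_contra hc
    unfold slot at h
    split_ifs at h <;> first | omega | linarith
  generalize hX : slot u1 u2 u3 u4 x = X at *
  generalize hY : slot u1 u2 u3 u4 y = Y at *
  generalize hZ : slot u1 u2 u3 u4 z = Z at *
  have e1 := mono x y
  have e2 := mono y z
  have e3 := mono x z
  have e4 := mono y x
  have e5 := mono z y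
  have e6 := mono z x
  rw [hX, hY] at e1
  rw [hY, hZ] at e2
  rw [hX, hZ] at e3
  rw [hX, hY] at e4
  rw [hY, hZ] at e5
  rw [hX, hZ] at e6
  clear mono
  unfold cyc3
  grind

/-- half-open arcs -/
lemma arc_map (f : ↥HomeoPos) (t : S1 → ℝ) (ht : Function.Injective t)
    (hc : ∀ x y z, circOrd x y z = cyc3 (t x) (t y) (t z)) (p q p' q' z : S1)
    (hp : ap f p = p') (hq : ap f q = q') (hpq : t p' < t q')
    (hz : z = p ∨ cyc3 (t p) (t z) (t q) = 1) : t p' ≤ t (ap f z) ∧ t (ap f z) < t q' := by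
  rcases hz with rfl | hz
  · rw [hp]; exact ⟨le_rfl, hpq⟩
  · rw [← hc, ← circOrd_ap f, hp, hq, hc] at hz
    unfold cyc3 at hz
    grind

lemma arc_map' (f : ↥HomeoPos) (t : S1 → ℝ) (ht : Function.Injective t)
    (hc : ∀ x y z, circOrd x y z = cyc3 (t x) (t y) (t z)) (p q p' q' z : S1)
    (hp : ap f p = p') (hq : ap f q = q') (hpq : t q' < t p') (hm : ∀ w, t q' ≤ t w)
    (hz : z = p ∨ cyc3 (t p) (t z) (t q) = 1) : t p' ≤ t (ap f z) := by
  rcases hz with rfl | hz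
  · rw [hp]
  · rw [← hc, ← circOrd_ap f, hp, hq, hc] at hz
    have := hm (ap f z)
    unfold cyc3 at hz
    grind

lemma ap_inv_of (f : ↥HomeoPos) {x y : S1} (h : ap f x = y) : ap f⁻¹ y = x := by
  rw [← h, ← ap_mul, inv_mul_cancel, ap_one]

lemma key (ρ : FreeGroup (Fin 2) →* ↥HomeoPos) (x₀ : S1)
    (a b : FreeGroup (Fin 2)) (ha : a = FreeGroup.of 0) (hb : b = FreeGroup.of 1)
    (hρ : circOrd x₀ (ap (ρ (a * b⁻¹ * a⁻¹ * b)) x₀) (ap (ρ b) x₀) = 1 ∧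
      circOrd x₀ (ap (ρ b) x₀) (ap (ρ (a⁻¹ * b)) x₀) = 1 ∧
      circOrd x₀ (ap (ρ (a⁻¹ * b)) x₀) (ap (ρ (b⁻¹ * a⁻¹ * b)) x₀) = 1) :
    ∃ (t : S1 → ℝ) (u1 u2 u3 u4 : ℝ), u1 < u2 ∧ u2 < u3 ∧ u3 < u4 ∧
      (∀ x y z, circOrd x y z = cyc3 (t x) (t y) (t z)) ∧
      ∀ g : FreeGroup (Fin 2), slot u1 u2 u3 u4 (t (ap (ρ g) x₀)) = wordIdx g.toWord := by
  obtain ⟨t, ht, hm, hc⟩ := exists_cut x₀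
  obtain ⟨y4, hy4⟩ : ∃ y, y = ap (ρ (a * b⁻¹ * a⁻¹ * b)) x₀ := ⟨_, rfl⟩
  obtain ⟨y1, hy1⟩ : ∃ y, y = ap (ρ b) x₀ := ⟨_, rfl⟩
  obtain ⟨y2, hy2⟩ : ∃ y, y = ap (ρ (a⁻¹ * b)) x₀ := ⟨_, rfl⟩
  obtain ⟨y3, hy3⟩ : ∃ y, y = ap (ρ (b⁻¹ * a⁻¹ * b)) x₀ := ⟨_, rfl⟩
  rw [← hy4, ← hy1, ← hy2, ← hy3, hc, hc, hc] at hρ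
  have A34 : ap (ρ a) y3 = y4 := by
    rw [hy3, hy4, ← ap_mul, ← map_mul]; simp only [mul_assoc]
  have A21 : ap (ρ a) y2 = y1 := by
    rw [hy2, hy1, ← ap_mul, ← map_mul]; simp
  have B01 : ap (ρ b) x₀ = y1 := hy1.symm
  have B32 : ap (ρ b) y3 = y2 := by
    rw [hy2, hy3, ← ap_mul, ← map_mul]; simp [mul_assoc]
  have A43 := ap_inv_of _ A34
  have A12 := ap_inv_of _ A21
  have B10 := ap_inv_of _ B01
  have B23 := ap_inv_of _ B32
  have m1 := hm y1
  have m2 := hm y2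
  have m3 := hm y3
  have m4 := hm y4
  obtain ⟨h1, h2, h3⟩ := hρ
  have o01 : t x₀ < t y4 := by unfold cyc3 at h1; grind
  have o12 : t y4 < t y1 := by unfold cyc3 at h1; grind
  have o23 : t y1 < t y2 := by unfold cyc3 at h2; grind
  have o34 : t y2 < t y3 := by unfold cyc3 at h3; grind
  clear h1 h2 h3
  have sA : ∀ z, slot (t y4) (t y1) (t y2) (t y3) (t z) ≠ 3 →
      slot (t y4) (t y1) (t y2) (t y3) (t (ap (ρ a) z)) = 1 := by
    intro z hz
    have hz' : z = y3 ∨ cyc3 (t y3) (t z) (t y2) = 1 := by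
      rw [← ht.eq_iff]
      unfold slot at hz; unfold cyc3; grind
    have := arc_map _ t ht hc _ _ _ _ z A34 A21 o12 hz'
    unfold slot; grind
  have sA' : ∀ z, slot (t y4) (t y1) (t y2) (t y3) (t z) ≠ 1 →
      slot (t y4) (t y1) (t y2) (t y3) (t (ap (ρ a)⁻¹ z)) = 3 := by
    intro z hz
    have hz' : z = y1 ∨ cyc3 (t y1) (t z) (t y4) = 1 := by
      rw [← ht.eq_iff]
      unfold slot at hz; unfold cyc3; grind
    have := arc_map _ t ht hc _ _ _ _ z A12 A43 o34 hz'
    unfold slot; grind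
  have sB : ∀ z, slot (t y4) (t y1) (t y2) (t y3) (t z) ≠ 4 →
      slot (t y4) (t y1) (t y2) (t y3) (t (ap (ρ b) z)) = 2 := by
    intro z hz
    have hz' : z = x₀ ∨ cyc3 (t x₀) (t z) (t y3) = 1 := by
      rw [← ht.eq_iff]
      have := hm z
      unfold slot at hz; unfold cyc3; grind
    have := arc_map _ t ht hc _ _ _ _ z B01 B32 o23 hz'
    unfold slot; grind
  have sB' : ∀ z, slot (t y4) (t y1) (t y2) (t y3) (t z) ≠ 2 →
      slot (t y4) (t y1) (t y2) (t y3) (t (ap (ρ b)⁻¹ z)) = 4 := by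
    intro z hz
    have hz' : z = y2 ∨ cyc3 (t y2) (t z) (t y1) = 1 := by
      rw [← ht.eq_iff]
      unfold slot at hz; unfold cyc3; grind
    have := arc_map' _ t ht hc _ _ _ _ z B23 B10 (by linarith) hm hz'
    unfold slot; grind
  refine ⟨t, t y4, t y1, t y2, t y3, o12, o23, o34, hc, ?_⟩
  have main : ∀ L : List (Fin 2 × Bool), FreeGroup.IsReduced L →
      slot (t y4) (t y1) (t y2) (t y3) (t (ap (ρ (FreeGroup.mk L)) x₀)) = wordIdx L := by
    intro L
    induction L with
    | nil =>
      intro _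
      rw [← FreeGroup.one_eq_mk, map_one, ap_one]
      simp [slot, o01, wordIdx]
    | cons s L ih =>
      intro hL
      have hL' : FreeGroup.IsReduced L := hL.infix ⟨[s], [], by simp⟩
      have ih := ih hL'
      have hne : wordIdx L ≠ letterIdx (s.1, !s.2) := by
        cases L with
        | nil => obtain ⟨i, e⟩ := s; fin_cases i <;> cases e <;> simp [wordIdx, letterIdx]
        | cons r L =>
          have := (FreeGroup.isReduced_cons_cons.1 hL).1
          obtain ⟨i, e⟩ := s
          obtain ⟨j, f⟩ := r
          revert this
          fin_cases i <;> cases e <;> fin_cases j <;> cases f <;> simp [wordIdx, letterIdx]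
      rw [← ih] at hne
      have emk : FreeGroup.mk (s :: L) = FreeGroup.mk [s] * FreeGroup.mk L := by
        rw [FreeGroup.mul_mk]; rfl
      rw [emk, map_mul, ap_mul]
      clear emk
      obtain ⟨i, ε⟩ := s
      have ea : FreeGroup.mk [((0 : Fin 2), false)] = a⁻¹ := by rw [ha]; rfl
      have eb : FreeGroup.mk [((1 : Fin 2), false)] = b⁻¹ := by rw [hb]; rfl
      have ea' : FreeGroup.mk [((0 : Fin 2), true)] = a := by rw [ha]; rfl
      have eb' : FreeGroup.mk [((1 : Fin 2), true)] = b := by rw [hb]; rfl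
      fin_cases i <;> cases ε
      · simp only [Fin.zero_eta, ea, map_inv]; exact sA' _ hne
      · simp only [Fin.zero_eta, ea']; exact sA _ hne
      · simp only [Fin.mk_one, eb, map_inv]; exact sB' _ hne
      · simp only [Fin.mk_one, eb']; exact sB _ hne
  intro g
  have := main g.toWord FreeGroup.isReduced_toWord
  rwa [FreeGroup.mk_toWord] at this

lemma letterIdx_pos (s : Fin 2 × Bool) : letterIdx s ≠ 0 := by
  unfold letterIdx; split_ifs <;> simp

lemma letterIdx_inj {s r : Fin 2 × Bool} (h : letterIdx s = letterIdx r) : s = r := by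
  obtain ⟨i, e⟩ := s
  obtain ⟨j, f⟩ := r
  revert h
  fin_cases i <;> cases e <;> fin_cases j <;> cases f <;> simp [letterIdx]

lemma key_stab (ρ : FreeGroup (Fin 2) →* ↥HomeoPos) (x₀ : S1) (f : S1 → ℕ)
    (h : ∀ g : FreeGroup (Fin 2), f (ap (ρ g) x₀) = wordIdx g.toWord) :
    TrivialStabilizer ρ x₀ := by
  intro g hg
  have h1 := h g
  have h2 := h 1
  rw [map_one, ap_one] at h2
  rw [hg, h2, FreeGroup.toWord_one] at h1
  rw [← FreeGroup.toWord_eq_nil_iff]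
  cases hw : g.toWord with
  | nil => rfl
  | cons s L => rw [hw] at h1; exact absurd h1.symm (letterIdx_pos s)

lemma same_idx (g h : FreeGroup (Fin 2)) (e : wordIdx g.toWord = wordIdx h.toWord) :
    g = h ∨ ∃ s : FreeGroup (Fin 2), s.norm ≤ 1 ∧ (s * g).norm < g.norm ∧
      (s * h).norm < h.norm := by
  cases hg : g.toWord with
  | nil =>
    cases hh : h.toWord with
    | nil => left; apply FreeGroup.toWord_injective; rw [hg, hh]
    | cons r M => rw [hg, hh] at e; exact absurd e.symm (letterIdx_pos r)
  | cons s L =>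
    cases hh : h.toWord with
    | nil => rw [hg, hh] at e; exact absurd e (letterIdx_pos s)
    | cons r M =>
      rw [hg, hh] at e
      obtain rfl : s = r := letterIdx_inj e
      have aux : ∀ (k : FreeGroup (Fin 2)) (N : List (Fin 2 × Bool)), k.toWord = s :: N →
          ((FreeGroup.mk [s])⁻¹ * k).norm < k.norm := by
        intro k N hk
        have e1 : k = FreeGroup.mk [s] * FreeGroup.mk N := by
          rw [FreeGroup.mul_mk, ← FreeGroup.mk_toWord (x := k), hk]; rfl
        have e2 : k.norm = N.length + 1 := by
          unfold FreeGroup.norm; rw [hk]; rfl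
        rw [e2, e1, inv_mul_cancel_left]
        have := FreeGroup.norm_mk_le (L₁ := N)
        omega
      refine Or.inr ⟨(FreeGroup.mk [s])⁻¹, ?_, aux g L hg, aux h M hh⟩
      rw [FreeGroup.norm_inv_eq]
      exact FreeGroup.norm_mk_le

lemma inducedCO_mul (ρ : FreeGroup (Fin 2) →* ↥HomeoPos) (x₀ : S1)
    (s g h k : FreeGroup (Fin 2)) :
    inducedCO ρ x₀ (s * g) (s * h) (s * k) = inducedCO ρ x₀ g h k := by
  unfold inducedCO
  rw [map_mul, map_mul, map_mul, ap_mul, ap_mul, ap_mul, circOrd_ap]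

lemma inducedCO_deg (ρ : FreeGroup (Fin 2) →* ↥HomeoPos) (x₀ : S1)
    (g h k : FreeGroup (Fin 2)) (hd : g = h ∨ h = k ∨ g = k) :
    inducedCO ρ x₀ g h k = 0 := by
  unfold inducedCO circOrd
  rw [if_pos]
  rcases hd with h | h | h <;> simp [h]

lemma co_eq (ρ ρ' : FreeGroup (Fin 2) →* ↥HomeoPos) (x₀ : S1)
    (H : ∀ g h k : FreeGroup (Fin 2), wordIdx g.toWord ≠ wordIdx h.toWord →
      wordIdx h.toWord ≠ wordIdx k.toWord → wordIdx g.toWord ≠ wordIdx k.toWord →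
      inducedCO ρ x₀ g h k = inducedCO ρ' x₀ g h k) :
    ∀ (n : ℕ) (g h k : FreeGroup (Fin 2)), g.norm + h.norm + k.norm = n →
      inducedCO ρ x₀ g h k = inducedCO ρ' x₀ g h k := by
  intro n
  induction n using Nat.strong_induction_on with
  | _ n ih =>
    intro g h k hn
    have deg : (g = h ∨ h = k ∨ g = k) → inducedCO ρ x₀ g h k = inducedCO ρ' x₀ g h k := by
      intro hd
      rw [inducedCO_deg ρ x₀ g h k hd, inducedCO_deg ρ' x₀ g h k hd]
    have step : ∀ s : FreeGroup (Fin 2), (s * g).norm + (s * h).norm + (s * k).norm < n →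
        inducedCO ρ x₀ g h k = inducedCO ρ' x₀ g h k := by
      intro s hs
      have := ih _ hs _ _ _ rfl
      rwa [inducedCO_mul, inducedCO_mul] at this
    by_cases h1 : wordIdx g.toWord = wordIdx h.toWord
    · rcases same_idx _ _ h1 with e | ⟨s, hs, e1, e2⟩
      · exact deg (Or.inl e)
      · have := FreeGroup.norm_mul_le s k
        exact step s (by omega)
    by_cases h2 : wordIdx h.toWord = wordIdx k.toWord
    · rcases same_idx _ _ h2 with e | ⟨s, hs, e1, e2⟩
      · exact deg (Or.inr (Or.inl e))
      · have := FreeGroup.norm_mul_le s g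
        exact step s (by omega)
    by_cases h3 : wordIdx g.toWord = wordIdx k.toWord
    · rcases same_idx _ _ h3 with e | ⟨s, hs, e1, e2⟩
      · exact deg (Or.inr (Or.inr e))
      · have := FreeGroup.norm_mul_le s h
        exact step s (by omega)
    exact H g h k h1 h2 h3

end

noncomputable section

/-- **An explicit singleton neighborhood in `CO(F₂)`.**  If two actions `ρ, ρ'` of the free
group `F₂ = ⟨a,b⟩` on the circle both place the five points
`x₀, ρ(ab⁻¹a⁻¹b)x₀, ρ(b)x₀, ρ(a⁻¹b)x₀, ρ(b⁻¹a⁻¹b)x₀` in counterclockwise cyclic order,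
then `x₀` has trivial stabilizer under both actions and the two induced circular orders on
`F₂` coincide. -/
theorem explicit_singleton_neighborhood
    (ρ ρ' : FreeGroup (Fin 2) →* ↥HomeoPos) (x₀ : S1)
    (a b : FreeGroup (Fin 2)) (ha : a = FreeGroup.of 0) (hb : b = FreeGroup.of 1)
    (hρ : circOrd x₀ (ap (ρ (a * b⁻¹ * a⁻¹ * b)) x₀) (ap (ρ b) x₀) = 1 ∧
      circOrd x₀ (ap (ρ b) x₀) (ap (ρ (a⁻¹ * b)) x₀) = 1 ∧
      circOrd x₀ (ap (ρ (a⁻¹ * b)) x₀) (ap (ρ (b⁻¹ * a⁻¹ * b)) x₀) = 1)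
    (hρ' : circOrd x₀ (ap (ρ' (a * b⁻¹ * a⁻¹ * b)) x₀) (ap (ρ' b) x₀) = 1 ∧
      circOrd x₀ (ap (ρ' b) x₀) (ap (ρ' (a⁻¹ * b)) x₀) = 1 ∧
      circOrd x₀ (ap (ρ' (a⁻¹ * b)) x₀) (ap (ρ' (b⁻¹ * a⁻¹ * b)) x₀) = 1) :
    TrivialStabilizer ρ x₀ ∧ TrivialStabilizer ρ' x₀ ∧
    ∀ g h k : FreeGroup (Fin 2),
      inducedCO ρ x₀ g h k = inducedCO ρ' x₀ g h k := by
  obtain ⟨t, u1, u2, u3, u4, h12, h23, h34, hc, hs⟩ := key ρ x₀ a b ha hb hρ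
  obtain ⟨t', v1, v2, v3, v4, k12, k23, k34, hc', hs'⟩ := key ρ' x₀ a b ha hb hρ'
  refine ⟨key_stab ρ x₀ (fun z => slot u1 u2 u3 u4 (t z)) hs,
    key_stab ρ' x₀ (fun z => slot v1 v2 v3 v4 (t' z)) hs', ?_⟩
  intro g h k
  refine co_eq ρ ρ' x₀ ?_ _ g h k rfl
  intro g h k e1 e2 e3
  unfold inducedCO
  rw [hc, hc', cyc3_slot u1 u2 u3 u4 _ _ _ h12 h23 h34 (by rwa [hs, hs]) (by rwa [hs, hs])
      (by rwa [hs, hs]),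
    cyc3_slot v1 v2 v3 v4 _ _ _ k12 k23 k34 (by rwa [hs', hs']) (by rwa [hs', hs'])
      (by rwa [hs', hs']), hs, hs, hs, hs', hs', hs']

end
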